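/- Let (μ_n) and (ν_n) be sequences of Borel probability measures on a compact metric space X such that (1/3)·ν_n ≤ μ_n ≤ 3·ν_n for all n. If ν_n converges weakly-* to an ergodic invariant measure ν of a continuous map g: X → X, and every weak-* accumulation point of (μ_n) is g-invariant, then μ_n converges weakly-* to ν. -/

import Mathlib

open MeasureTheory Filter Topology
open scoped ENNReal

theorem stmt3 {X : Type*} [MetricSpace X] [CompactSpace X]
    [MeasurableSpace X] [BorelSpace X]
    (g : X → X) (hg : Continuous g)
    (μseq νseq : ℕ → Measure X)
    (hμp : ∀ n, IsProbabilityMeasure (μseq n)) (hνp : ∀ n, IsProbabilityMeasure (νseq n))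
    (hsand : ∀ n, (3 : ℝ≥0∞)⁻¹ • νseq n ≤ μseq n ∧ μseq n ≤ (3 : ℝ≥0∞) • νseq n)
    (ν : Measure X) (hνpr : IsProbabilityMeasure ν)
    (hνinv : ν.map g = ν)
    (hνerg : ∀ A : Set X, MeasurableSet A → g ⁻¹' A = A → ν A = 0 ∨ ν A = 1)
    (hνconv : ∀ φ : C(X, ℝ),
      Tendsto (fun n => ∫ x, φ x ∂(νseq n)) atTop (𝓝 (∫ x, φ x ∂ν)))
    (hacc : ∀ lam : Measure X, IsProbabilityMeasure lam →
      (∃ σ : ℕ → ℕ, StrictMono σ ∧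
        ∀ φ : C(X, ℝ),
          Tendsto (fun n => ∫ x, φ x ∂(μseq (σ n))) atTop (𝓝 (∫ x, φ x ∂lam))) →
      lam.map g = lam) :
    ∀ φ : C(X, ℝ),
      Tendsto (fun n => ∫ x, φ x ∂(μseq n)) atTop (𝓝 (∫ x, φ x ∂ν)) := by
  have key : ∀ σ : ℕ → ℕ, StrictMono σ → ∀ lam : Measure X, IsProbabilityMeasure lam →
      (∀ φ : C(X, ℝ),
        Tendsto (fun n => ∫ x, φ x ∂(μseq (σ n))) atTop (𝓝 (∫ x, φ x ∂lam))) → lam = ν := by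
    intro σ hσ lam hlam hconv
    have hinv := hacc lam hlam ⟨σ, hσ, hconv⟩
    have herg : Ergodic g ν :=
      { measurable := hg.measurable
        map_eq := hνinv
        aeconst_set := by
          intro s hs hgs
          rw [eventuallyConst_set']
          rcases hνerg s hs hgs with h | h
          · left
            exact ae_eq_empty.2 h
          · right
            exact ae_eq_univ.2 ((prob_compl_eq_zero_iff hs).2 h) }
    have hint : ∀ φ : C(X, ℝ), (∀ x, 0 ≤ φ x) → ∫ x, φ x ∂lam ≤ 3 * ∫ x, φ x ∂ν := by
      intro φ hφ
      refine le_of_tendsto_of_tendsto' (hconv φ)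
        (((hνconv φ).comp hσ.tendsto_atTop).const_mul 3) fun n => ?_
      have hi : Integrable (fun x => φ x) (νseq (σ n)) :=
        φ.continuous.integrable_of_hasCompactSupport (HasCompactSupport.of_compactSpace _)
      have h1 := integral_mono_measure (hsand (σ n)).2 (Eventually.of_forall hφ)
        (hi.smul_measure (by simp))
      rw [integral_smul_measure] at h1
      simpa using h1
    have hF : ∀ F : Set X, IsClosed F → lam.real F ≤ 3 * ν.real F := by
      intro F hFc
      have hpos : ∀ n : ℕ, (0 : ℝ) < 1 / ((n : ℝ) + 1) := fun n => Nat.one_div_pos_of_nat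
      have hlim : Tendsto (fun n : ℕ => (1 : ℝ) / ((n : ℝ) + 1)) atTop (𝓝 0) :=
        tendsto_one_div_add_atTop_nhds_zero_nat
      refine le_of_tendsto_of_tendsto'
        (tendsto_integral_thickenedIndicator_of_isClosed lam hFc hpos hlim)
        ((tendsto_integral_thickenedIndicator_of_isClosed ν hFc hpos hlim).const_mul 3)
        fun n => ?_
      exact hint ⟨fun x => (thickenedIndicator (hpos n) F x : ℝ), by fun_prop⟩
        (fun x => NNReal.coe_nonneg _)
    have hac : lam ≪ ν := by
      refine Measure.AbsolutelyContinuous.mk fun A hA h0 => ?_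
      rw [hA.measure_eq_iSup_isClosed_of_ne_top (measure_ne_top lam A)]
      simp only [ENNReal.iSup_eq_zero]
      intro F hFA hFc
      have h1 : ν F = 0 := measure_mono_null hFA h0
      have h2 := hF F hFc
      have h3 : ν.real F = 0 := by simp [Measure.real, h1]
      rw [h3, mul_zero] at h2
      exact (measureReal_eq_zero_iff).1 (le_antisymm h2 measureReal_nonneg)
    exact herg.eq_of_absolutelyContinuous ⟨hg.measurable, hinv⟩ hac
  intro φ
  refine tendsto_of_subseq_tendsto fun ns hns => ?_
  obtain ⟨a, ha, hna⟩ := strictMono_subseq_of_tendsto_atTop hns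
  obtain ⟨L, b, hb, hL⟩ := CompactSpace.tendsto_subseq (X := ProbabilityMeasure X)
    (fun n => (⟨μseq (ns (a n)), hμp _⟩ : ProbabilityMeasure X))
  have hc : ∀ φ : C(X, ℝ), Tendsto (fun n => ∫ x, φ x ∂(μseq (ns (a (b n))))) atTop
      (𝓝 (∫ x, φ x ∂(L : Measure X))) := fun φ =>
    ProbabilityMeasure.tendsto_iff_forall_integral_tendsto.1 hL
      (BoundedContinuousFunction.mkOfCompact φ)
  have hLν := key (fun n => ns (a (b n))) (hna.comp hb) L inferInstance hc
  refine ⟨fun n => a (b n), ?_⟩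
  rw [← hLν]
  exact hc φ
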